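/- arXiv:1509.05156 — 2 statements merged into one kernel-verified Lean document; each statement's English description precedes it below -/
import Mathlib

section
/- On an oriented Riemannian 3-manifold, the Cotton tensor Cott := * d^∇ Sch is a symmetric 2-tensor, where Sch = Ric - (scal/4)g is the Schouten tensor and * is the Hodge star applied to the 2-form part. -/
open scoped BigOperators
noncomputable section

/-- Points of a chart of a 3-manifold. -/
abbrev E3 := Fin 3 → ℝ

/-- A Riemannian metric in a chart: components `g x i j` at each point. -/
abbrev Metric3 := E3 → Fin 3 → Fin 3 → ℝ

/-- Partial derivative in the `k`-th coordinate direction. -/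
def pd (k : Fin 3) (h : E3 → ℝ) (x : E3) : ℝ :=
  fderiv ℝ h x (Pi.single k 1)

/-- Components `g^{ij}` of the inverse metric. -/
def ginv (g : Metric3) (x : E3) (i j : Fin 3) : ℝ :=
  (Matrix.of (g x))⁻¹ i j

/-- Christoffel symbols `Γ^k_{ij}` of the Levi-Civita connection of `g`. -/
def Gamma (g : Metric3) (x : E3) (k i j : Fin 3) : ℝ :=
  (1 / 2) * ∑ l, ginv g x k l *
    (pd i (fun y => g y j l) x + pd j (fun y => g y i l) x - pd l (fun y => g y i j) x)

/-- Components of the Riemann curvature tensor: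
`Riemann g x l i j k` is the `l`-th component of `R(∂_i,∂_j)∂_k`. -/
def Riemann (g : Metric3) (x : E3) (l i j k : Fin 3) : ℝ :=
  pd i (fun y => Gamma g y l j k) x - pd j (fun y => Gamma g y l i k) x
    + ∑ m, Gamma g x l i m * Gamma g x m j k
    - ∑ m, Gamma g x l j m * Gamma g x m i k

/-- The Ricci tensor `Ric(U,V) = tr (X ↦ R(X,U)V)`. -/
def Ricci (g : Metric3) (x : E3) (i j : Fin 3) : ℝ := ∑ l, Riemann g x l l i j

/-- The scalar curvature, the `g`-trace of the Ricci tensor. -/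
def Scal (g : Metric3) (x : E3) : ℝ := ∑ i, ∑ j, ginv g x i j * Ricci g x i j

/-- The Schouten tensor in dimension 3: `Sch = Ric - (scal/4) g`. -/
def Schouten (g : Metric3) (x : E3) (i j : Fin 3) : ℝ :=
  Ricci g x i j - Scal g x / 4 * g x i j

/-- The covariant derivative `(∇_{∂_k} T)(∂_i, ∂_j)` of a 2-tensor field `T`. -/
def covDeriv (g : Metric3) (T : E3 → Fin 3 → Fin 3 → ℝ) (k : Fin 3) (x : E3)
    (i j : Fin 3) : ℝ :=
  pd k (fun y => T y i j) x - ∑ m, Gamma g x m k i * T x m j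
    - ∑ m, Gamma g x m k j * T x i m

/-- The Cotton form `cott = d^∇ Sch`, as an all-covariant 3-tensor:
`CottonForm g x k i j = (d^∇ Sch)(∂_k, ∂_i)(∂_j) = (∇_k Sch)(i,j) - (∇_i Sch)(k,j)`. -/
def CottonForm (g : Metric3) (x : E3) (k i j : Fin 3) : ℝ :=
  covDeriv g (fun y => Schouten g y) k x i j - covDeriv g (fun y => Schouten g y) i x k j

/-- The Levi-Civita alternating symbol on three indices. -/
def eps3 (a b c : Fin 3) : ℝ :=
  if (a, b, c) = (0, 1, 2) ∨ (a, b, c) = (1, 2, 0) ∨ (a, b, c) = (2, 0, 1) then 1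
  else if (a, b, c) = (0, 2, 1) ∨ (a, b, c) = (2, 1, 0) ∨ (a, b, c) = (1, 0, 2) then -1
  else 0

/-- The Cotton tensor `Cott = * d^∇ Sch`, the Hodge star (of the oriented chart) being
applied to the 2-form part of the Cotton form. -/
def CottonTensor (g : Metric3) (x : E3) (m j : Fin 3) : ℝ :=
  Real.sqrt (Matrix.of (g x)).det / 2 *
    ∑ a, ∑ b, ∑ k, ∑ i, eps3 a b m * ginv g x a k * ginv g x b i * CottonForm g x k i j

/-- `g` is a (smooth) Riemannian metric: smooth, symmetric, positive definite. -/
structure IsRiemannian (g : Metric3) : Prop where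
  smooth : ContDiff ℝ (⊤ : ℕ∞) g
  symm : ∀ x i j, g x i j = g x j i
  posdef : ∀ x, (Matrix.of (g x)).PosDef


/-! ### Calculus of `pd` -/

abbrev Sm (f : E3 → ℝ) : Prop := ContDiff ℝ (⊤ : ℕ∞) f

lemma Sm.da {f : E3 → ℝ} (hf : Sm f) (x : E3) : DifferentiableAt ℝ f x :=
  (ContDiff.differentiable hf (by simp)).differentiableAt

lemma Sm.pd {f : E3 → ℝ} (hf : Sm f) (k : Fin 3) : Sm (pd k f) := by
  unfold _root_.pd Sm
  exact (ContDiff.fderiv_right (m := ((⊤ : ℕ∞) : WithTop ℕ∞)) hf (by simp)).clm_apply contDiff_const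

lemma pd_add' {f h : E3 → ℝ} (hf : Sm f) (hh : Sm h) (k : Fin 3) (x : E3) :
    pd k (fun y => f y + h y) x = pd k f x + pd k h x := by
  unfold pd
  rw [fderiv_fun_add (hf.da x) (hh.da x)]; simp

lemma pd_sub' {f h : E3 → ℝ} (hf : Sm f) (hh : Sm h) (k : Fin 3) (x : E3) :
    pd k (fun y => f y - h y) x = pd k f x - pd k h x := by
  unfold pd
  rw [fderiv_fun_sub (hf.da x) (hh.da x)]; simp

lemma pd_neg' {f : E3 → ℝ} (k : Fin 3) (x : E3) :
    pd k (fun y => - f y) x = - pd k f x := by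
  unfold pd
  rw [fderiv_fun_neg]; simp

lemma pd_const' (c : ℝ) (k : Fin 3) (x : E3) : pd k (fun _ => c) x = 0 := by
  unfold pd; simp

lemma pd_mul' {f h : E3 → ℝ} (hf : Sm f) (hh : Sm h) (k : Fin 3) (x : E3) :
    pd k (fun y => f y * h y) x = pd k f x * h x + f x * pd k h x := by
  unfold pd
  rw [fderiv_fun_mul (hf.da x) (hh.da x)]; simp; ring

lemma pd_sum' {f : Fin 3 → E3 → ℝ} (hf : ∀ n, Sm (f n)) (k : Fin 3) (x : E3) :
    pd k (fun y => ∑ n, f n y) x = ∑ n, pd k (f n) x := by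
  unfold pd
  rw [fderiv_fun_sum (fun n _ => (hf n).da x)]; simp

lemma pd_comm' {f : E3 → ℝ} (hf : Sm f) (i j : Fin 3) (x : E3) :
    pd i (fun y => pd j f y) x = pd j (fun y => pd i f y) x := by
  have h2 : IsSymmSndFDerivAt ℝ f x := by
    refine ContDiffAt.isSymmSndFDerivAt (n := ((⊤ : ℕ∞) : WithTop ℕ∞)) hf.contDiffAt ?_
    simp
    exact WithTop.coe_le_coe.2 (le_top : (2 : ℕ∞) ≤ ⊤)
  have hd : DifferentiableAt ℝ (fderiv ℝ f) x :=
    ((ContDiff.fderiv_right (m := ((⊤ : ℕ∞) : WithTop ℕ∞)) hf (by simp)).differentiable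
      (by simp)).differentiableAt
  have key : ∀ v w : E3, fderiv ℝ (fun y => fderiv ℝ f y v) x w = fderiv ℝ (fderiv ℝ f) x w v := by
    intro v w
    rw [fderiv_clm_apply hd (differentiableAt_const v)]; simp
  unfold pd
  rw [key, key]
  exact h2 _ _

lemma Sm.add {f h : E3 → ℝ} (hf : Sm f) (hh : Sm h) : Sm (fun y => f y + h y) :=
  ContDiff.add hf hh
lemma Sm.sub {f h : E3 → ℝ} (hf : Sm f) (hh : Sm h) : Sm (fun y => f y - h y) :=
  ContDiff.sub hf hh
lemma Sm.mul {f h : E3 → ℝ} (hf : Sm f) (hh : Sm h) : Sm (fun y => f y * h y) :=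
  ContDiff.mul hf hh
lemma Sm.sum {f : Fin 3 → E3 → ℝ} (hf : ∀ n, Sm (f n)) : Sm (fun y => ∑ n, f n y) :=
  ContDiff.sum fun n _ => hf n

/-! ### Smoothness -/

lemma g_sm {g : Metric3} (hg : IsRiemannian g) (i j : Fin 3) : Sm (fun y => g y i j) :=
  contDiff_pi.1 (contDiff_pi.1 hg.smooth i) j

lemma ginv_sm {g : Metric3} (hg : IsRiemannian g) (i j : Fin 3) : Sm (fun y => ginv g y i j) := by
  have hdet : Sm (fun y => (Matrix.of (g y)).det) := by
    have : ∀ a b, ContDiff ℝ (⊤ : ℕ∞) (fun y => g y a b) := g_sm hg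
    simp only [Matrix.det_fin_three, Matrix.of_apply]
    unfold Sm
    fun_prop
  have hadj : Sm (fun y => (Matrix.of (g y)).adjugate i j) := by
    have : ∀ a b, ContDiff ℝ (⊤ : ℕ∞) (fun y => g y a b) := g_sm hg
    simp only [Matrix.adjugate_fin_three, Matrix.of_apply]
    fin_cases i <;> fin_cases j <;> simp <;> unfold Sm <;> fun_prop
  have : (fun y => ginv g y i j)
      = fun y => ((Matrix.of (g y)).det)⁻¹ * (Matrix.of (g y)).adjugate i j := by
    funext y
    simp [ginv, Matrix.inv_def, Ring.inverse_eq_inv']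
  rw [this]
  exact ContDiff.mul (ContDiff.inv hdet fun y => (hg.posdef y).det_pos.ne') hadj

lemma Gamma_sm {g : Metric3} (hg : IsRiemannian g) (k i j : Fin 3) : Sm (fun y => Gamma g y k i j) := by
  unfold Gamma
  refine Sm.mul contDiff_const (Sm.sum fun l => Sm.mul (ginv_sm hg k l) ?_)
  exact Sm.sub (Sm.add ((g_sm hg j l).pd i) ((g_sm hg i l).pd j)) ((g_sm hg i j).pd l)

lemma Riemann_sm {g : Metric3} (hg : IsRiemannian g) (l i j k : Fin 3) : Sm (fun y => Riemann g y l i j k) := by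
  unfold Riemann
  refine Sm.sub (Sm.add (Sm.sub ((Gamma_sm hg _ _ _).pd _) ((Gamma_sm hg _ _ _).pd _))
    (Sm.sum fun m => ?_)) (Sm.sum fun m => ?_) <;>
  exact Sm.mul (Gamma_sm hg _ _ _) (Gamma_sm hg _ _ _)

lemma Ricci_sm {g : Metric3} (hg : IsRiemannian g) (i j : Fin 3) : Sm (fun y => Ricci g y i j) := by
  unfold Ricci
  exact Sm.sum fun l => Riemann_sm hg _ _ _ _

lemma Scal_sm {g : Metric3} (hg : IsRiemannian g) : Sm (fun y => Scal g y) := by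
  unfold Scal
  exact Sm.sum fun i => Sm.sum fun j => Sm.mul (ginv_sm hg _ _) (Ricci_sm hg _ _)

/-! ### Metric algebra -/

lemma ginv_mul {g : Metric3} (hg : IsRiemannian g) (x : E3) (i j : Fin 3) :
    ∑ m, ginv g x i m * g x m j = if i = j then 1 else 0 := by
  have h : (Matrix.of (g x))⁻¹ * Matrix.of (g x) = 1 :=
    Matrix.nonsing_inv_mul _ (hg.posdef x).det_pos.ne'.isUnit
  have := congrFun (congrFun h i) j
  rw [Matrix.mul_apply, Matrix.one_apply] at this
  exact this

lemma mul_ginv {g : Metric3} (hg : IsRiemannian g) (x : E3) (i j : Fin 3) :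
    ∑ m, g x i m * ginv g x m j = if i = j then 1 else 0 := by
  have h : Matrix.of (g x) * (Matrix.of (g x))⁻¹ = 1 :=
    Matrix.mul_nonsing_inv _ (hg.posdef x).det_pos.ne'.isUnit
  have := congrFun (congrFun h i) j
  rw [Matrix.mul_apply, Matrix.one_apply] at this
  exact this

lemma ginv_symm {g : Metric3} (hg : IsRiemannian g) (x : E3) (i j : Fin 3) : ginv g x i j = ginv g x j i := by
  have h : (Matrix.of (g x)).transpose = Matrix.of (g x) := by
    ext a b; exact hg.symm x b a
  have h2 := Matrix.transpose_nonsing_inv (Matrix.of (g x))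
  rw [h] at h2
  exact congrFun (congrFun h2 j) i

lemma Gamma_symm {g : Metric3} (hg : IsRiemannian g) (x : E3) (k i j : Fin 3) : Gamma g x k i j = Gamma g x k j i := by
  have : (fun y => g y i j) = fun y => g y j i := funext fun y => hg.symm y i j
  unfold Gamma
  rw [this]
  congr 1
  exact Finset.sum_congr rfl fun l _ => by ring

lemma Gamma_low {g : Metric3} (hg : IsRiemannian g) (x : E3) (k i j : Fin 3) :
    ∑ m, Gamma g x m k i * g x m j =
      (1 / 2) * (pd k (fun y => g y i j) x + pd i (fun y => g y k j) x
        - pd j (fun y => g y k i) x) := by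
  have h : ∀ l, ∑ m, ginv g x m l * g x m j = if l = j then 1 else 0 := by
    intro l
    rw [← ginv_mul hg x l j]
    exact Finset.sum_congr rfl fun m _ => by rw [ginv_symm hg]
  unfold Gamma
  generalize hF : (fun l => pd k (fun y => g y i l) x + pd i (fun y => g y k l) x
        - pd l (fun y => g y k i) x) = F
  have hF' : ∀ l, pd k (fun y => g y i l) x + pd i (fun y => g y k l) x
        - pd l (fun y => g y k i) x = F l := fun l => congrFun hF l
  simp only [hF']
  have : ∑ l, (∑ m, ginv g x m l * g x m j) * F l = F j := by
    simp only [h]; simp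
  rw [← this]
  simp only [Fin.sum_univ_three]
  ring

/-- metric compatibility -/
lemma pd_g {g : Metric3} (hg : IsRiemannian g) (x : E3) (k i j : Fin 3) :
    pd k (fun y => g y i j) x =
      ∑ m, Gamma g x m k i * g x m j + ∑ m, Gamma g x m k j * g x i m := by
  have e : ∑ m, Gamma g x m k j * g x i m = ∑ m, Gamma g x m k j * g x m i :=
    Finset.sum_congr rfl fun m _ => by rw [hg.symm x i m]
  rw [e, Gamma_low hg, Gamma_low hg]
  have : (fun y => g y j i) = fun y => g y i j := funext fun y => hg.symm y j i
  rw [this]; ring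

lemma pd_ginv {g : Metric3} (hg : IsRiemannian g) (x : E3) (k i j : Fin 3) :
    pd k (fun y => ginv g y i j) x =
      -(∑ m, Gamma g x i k m * ginv g x m j + ∑ m, Gamma g x j k m * ginv g x i m) := by
  have h1 : ∀ b, ∑ m, (pd k (fun y => ginv g y i m) x * g x m b
      + ginv g x i m * pd k (fun y => g y m b) x) = 0 := by
    intro b
    have : (fun y => ∑ m, ginv g y i m * g y m b) = fun _ => (if i = b then 1 else 0 : ℝ) :=
      funext fun y => ginv_mul hg y i b
    have h2 := congrArg (fun f => pd k f x) this
    simp only [pd_const'] at h2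
    rw [pd_sum' (fun n => Sm.mul (ginv_sm hg _ _) (g_sm hg _ _))] at h2
    rw [← h2]
    exact Finset.sum_congr rfl fun m _ => (pd_mul' (ginv_sm hg _ _) (g_sm hg _ _) _ _).symm
  simp only [pd_g hg] at h1
  have e1 : ∑ b, (∑ m, pd k (fun y => ginv g y i m) x * g x m b) * ginv g x b j
      = pd k (fun y => ginv g y i j) x := by
    have : ∑ b, (∑ m, pd k (fun y => ginv g y i m) x * g x m b) * ginv g x b j
      = ∑ m, pd k (fun y => ginv g y i m) x * ∑ b, g x m b * ginv g x b j := by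
      simp only [Fin.sum_univ_three]; ring
    rw [this]; simp [mul_ginv hg]
  have e2 : ∑ b, (∑ m, ginv g x i m * ∑ n, Gamma g x n k m * g x n b) * ginv g x b j
      = ∑ m, Gamma g x j k m * ginv g x i m := by
    have : ∑ b, (∑ m, ginv g x i m * ∑ n, Gamma g x n k m * g x n b) * ginv g x b j
      = ∑ m, ∑ n, ginv g x i m * Gamma g x n k m * ∑ b, g x n b * ginv g x b j := by
      simp only [Fin.sum_univ_three]; ring
    rw [this]; simp [mul_ginv hg, mul_comm]
  have e3 : ∑ b, (∑ m, ginv g x i m * ∑ n, Gamma g x n k b * g x m n) * ginv g x b j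
      = ∑ m, Gamma g x i k m * ginv g x m j := by
    have : ∑ b, (∑ m, ginv g x i m * ∑ n, Gamma g x n k b * g x m n) * ginv g x b j
      = ∑ n, (∑ m, ginv g x i m * g x m n) * ∑ b, Gamma g x n k b * ginv g x b j := by
      simp only [Fin.sum_univ_three]; ring
    rw [this]; simp [ginv_mul hg]
  have e4 : ∑ b, (∑ m, (pd k (fun y => ginv g y i m) x * g x m b
      + ginv g x i m * (∑ n, Gamma g x n k m * g x n b + ∑ n, Gamma g x n k b * g x m n)))
        * ginv g x b j = 0 := by
    simp only [h1]; simp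
  simp only [mul_add, Finset.sum_add_distrib, add_mul] at e4
  rw [e1, e2, e3] at e4
  linarith

/-! ### Curvature identities -/

lemma pd_pd_ginv {g : Metric3} (hg : IsRiemannian g) (x : E3) (i j a b : Fin 3) :
    pd i (fun z => pd j (fun y => ginv g y a b) z) x =
      -(∑ m, (pd i (fun y => Gamma g y a j m) x * ginv g x m b
          + Gamma g x a j m * pd i (fun y => ginv g y m b) x)
        + ∑ m, (pd i (fun y => Gamma g y b j m) x * ginv g x a m
          + Gamma g x b j m * pd i (fun y => ginv g y a m) x)) := by
  have : (fun z => pd j (fun y => ginv g y a b) z) = _ := funext fun z => pd_ginv hg z j a b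
  rw [this, pd_neg', pd_add' (Sm.sum fun m => Sm.mul (Gamma_sm hg _ _ _) (ginv_sm hg _ _))
    (Sm.sum fun m => Sm.mul (Gamma_sm hg _ _ _) (ginv_sm hg _ _)),
    pd_sum' (fun m => Sm.mul (Gamma_sm hg _ _ _) (ginv_sm hg _ _)),
    pd_sum' (fun m => Sm.mul (Gamma_sm hg _ _ _) (ginv_sm hg _ _))]
  simp only [pd_mul' (Gamma_sm hg _ _ _) (ginv_sm hg _ _)]

lemma Riemann_skew {g : Metric3} (hg : IsRiemannian g) (x : E3) (i j a b : Fin 3) :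
    ∑ n, (Riemann g x a i j n * ginv g x n b + Riemann g x b i j n * ginv g x a n) = 0 := by
  have h := pd_comm' (ginv_sm hg a b) i j x
  rw [pd_pd_ginv hg, pd_pd_ginv hg] at h
  simp only [pd_ginv hg] at h
  simp only [Riemann, Fin.sum_univ_three] at h ⊢
  linear_combination -h

lemma Riemann_antisymm {g : Metric3} (hg : IsRiemannian g) (x : E3) (l i j k : Fin 3) :
    Riemann g x l i j k = - Riemann g x l j i k := by
  unfold Riemann; ring

lemma pd_Riemann_antisymm {g : Metric3} (hg : IsRiemannian g) (x : E3) (m l i j k : Fin 3) :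
    pd m (fun y => Riemann g y l i j k) x = - pd m (fun y => Riemann g y l j i k) x := by
  rw [← pd_neg']; congr 1; funext y; exact Riemann_antisymm hg y l i j k

lemma pd_Riemann_skew {g : Metric3} (hg : IsRiemannian g) (x : E3) (m i j a b : Fin 3) :
    ∑ n, ((pd m (fun y => Riemann g y a i j n) x * ginv g x n b
        + Riemann g x a i j n * pd m (fun y => ginv g y n b) x)
      + (pd m (fun y => Riemann g y b i j n) x * ginv g x a n
        + Riemann g x b i j n * pd m (fun y => ginv g y a n) x)) = 0 := by
  have := congrArg (fun f => pd m f x) (funext fun y => Riemann_skew hg y i j a b)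
  simp only [pd_const'] at this
  have s : ∀ l i j k p q, Sm (fun y => Riemann g y l i j k * ginv g y p q) :=
    fun l i j k p q => Sm.mul (Riemann_sm hg _ _ _ _) (ginv_sm hg _ _)
  rw [pd_sum' (fun n => Sm.add (s _ _ _ _ _ _) (s _ _ _ _ _ _))] at this
  simp only [pd_add' (s _ _ _ _ _ _) (s _ _ _ _ _ _),
    pd_mul' (Riemann_sm hg _ _ _ _) (ginv_sm hg _ _)] at this
  exact this

lemma pd_Riemann {g : Metric3} (hg : IsRiemannian g) (x : E3) (m l i j k : Fin 3) :
    pd m (fun y => Riemann g y l i j k) x =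
      pd m (fun y => pd i (fun z => Gamma g z l j k) y) x
      - pd m (fun y => pd j (fun z => Gamma g z l i k) y) x
      + ∑ n, (pd m (fun y => Gamma g y l i n) x * Gamma g x n j k
        + Gamma g x l i n * pd m (fun y => Gamma g y n j k) x)
      - ∑ n, (pd m (fun y => Gamma g y l j n) x * Gamma g x n i k
        + Gamma g x l j n * pd m (fun y => Gamma g y n i k) x) := by
  have G := Gamma_sm hg
  have s : ∀ l i k p q r, Sm (fun y => Gamma g y l i k * Gamma g y p q r) :=
    fun l i k p q r => Sm.mul (G _ _ _) (G _ _ _)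
  unfold Riemann
  rw [pd_sub' (Sm.add (Sm.sub ((G _ _ _).pd _) ((G _ _ _).pd _)) (Sm.sum fun n => s _ _ _ _ _ _))
      (Sm.sum fun n => s _ _ _ _ _ _),
    pd_add' (Sm.sub ((G _ _ _).pd _) ((G _ _ _).pd _)) (Sm.sum fun n => s _ _ _ _ _ _),
    pd_sub' ((G _ _ _).pd _) ((G _ _ _).pd _),
    pd_sum' (fun n => s _ _ _ _ _ _), pd_sum' (fun n => s _ _ _ _ _ _)]
  simp only [pd_mul' (G _ _ _) (G _ _ _)]

/-- Covariant derivative of the curvature tensor. -/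
def nR (g : Metric3) (x : E3) (m l i j k : Fin 3) : ℝ :=
  pd m (fun y => Riemann g y l i j k) x
    + ∑ n, Gamma g x l m n * Riemann g x n i j k
    - ∑ n, Gamma g x n m i * Riemann g x l n j k
    - ∑ n, Gamma g x n m j * Riemann g x l i n k
    - ∑ n, Gamma g x n m k * Riemann g x l i j n

lemma nR_antisymm {g : Metric3} (hg : IsRiemannian g) (x : E3) (m l i j k : Fin 3) : nR g x m l i j k = - nR g x m l j i k := by
  unfold nR
  rw [pd_Riemann_antisymm hg]
  simp only [fun n => Riemann_antisymm hg x n i j k, fun n => Riemann_antisymm hg x l n j k,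
    fun n => Riemann_antisymm hg x l i n k, fun n => Riemann_antisymm hg x l i j n,
    Fin.sum_univ_three]
  ring

lemma bianchi0 {g : Metric3} (hg : IsRiemannian g) (x : E3) (m l i j k : Fin 3) :
    (pd m (fun y => Riemann g y l i j k) x
      + ∑ n, (Gamma g x l m n * Riemann g x n i j k - Gamma g x n m k * Riemann g x l i j n))
    + (pd i (fun y => Riemann g y l j m k) x
      + ∑ n, (Gamma g x l i n * Riemann g x n j m k - Gamma g x n i k * Riemann g x l j m n))
    + (pd j (fun y => Riemann g y l m i k) x
      + ∑ n, (Gamma g x l j n * Riemann g x n m i k - Gamma g x n j k * Riemann g x l m i n))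
    = 0 := by
  rw [pd_Riemann hg, pd_Riemann hg, pd_Riemann hg]
  have c1 := pd_comm' (Gamma_sm hg l j k) m i x
  have c2 := pd_comm' (Gamma_sm hg l i k) m j x
  have c3 := pd_comm' (Gamma_sm hg l m k) i j x
  simp only [Riemann, Fin.sum_univ_three]
  linear_combination c1 - c2 + c3

lemma bianchi {g : Metric3} (hg : IsRiemannian g) (x : E3) (m l i j k : Fin 3) :
    nR g x m l i j k + nR g x i l j m k + nR g x j l m i k = 0 := by
  rw [← bianchi0 hg x m l i j k]
  unfold nR
  have a1 : ∑ n, Gamma g x n m i * Riemann g x l n j k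
      = - ∑ n, Gamma g x n i m * Riemann g x l j n k := by
    rw [← Finset.sum_neg_distrib]
    exact Finset.sum_congr rfl fun n _ => by
      rw [Gamma_symm hg x n m i, Riemann_antisymm hg x l n j k]; ring
  have a2 : ∑ n, Gamma g x n i j * Riemann g x l n m k
      = - ∑ n, Gamma g x n j i * Riemann g x l m n k := by
    rw [← Finset.sum_neg_distrib]
    exact Finset.sum_congr rfl fun n _ => by
      rw [Gamma_symm hg x n i j, Riemann_antisymm hg x l n m k]; ring
  have a3 : ∑ n, Gamma g x n j m * Riemann g x l n i k
      = - ∑ n, Gamma g x n m j * Riemann g x l i n k := by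
    rw [← Finset.sum_neg_distrib]
    exact Finset.sum_congr rfl fun n _ => by
      rw [Gamma_symm hg x n j m, Riemann_antisymm hg x l n i k]; ring
  rw [a1, a2, a3]
  simp only [Finset.sum_sub_distrib]
  ring

lemma nR_skew {g : Metric3} (hg : IsRiemannian g) (x : E3) (m i j a b : Fin 3) :
    ∑ n, (nR g x m a i j n * ginv g x n b + nR g x m b i j n * ginv g x a n) = 0 := by
  have h := pd_Riemann_skew hg x m i j a b
  have h0 := fun i j a b => Riemann_skew hg x i j a b
  have t1 : ∑ p, Gamma g x a m p * ∑ n, (Riemann g x p i j n * ginv g x n b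
      + Riemann g x b i j n * ginv g x p n) = 0 := by simp only [h0]; simp
  have t2 : ∑ p, Gamma g x b m p * ∑ n, (Riemann g x a i j n * ginv g x n p
      + Riemann g x p i j n * ginv g x a n) = 0 := by simp only [h0]; simp
  have t3 : ∑ p, Gamma g x p m i * ∑ n, (Riemann g x a p j n * ginv g x n b
      + Riemann g x b p j n * ginv g x a n) = 0 := by simp only [h0]; simp
  have t4 : ∑ p, Gamma g x p m j * ∑ n, (Riemann g x a i p n * ginv g x n b
      + Riemann g x b i p n * ginv g x a n) = 0 := by simp only [h0]; simp
  simp only [pd_ginv hg] at h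
  simp only [nR, Fin.sum_univ_three] at h t1 t2 t3 t4 ⊢
  linear_combination h + t1 + t2 - t3 - t4

lemma nR_ricci {g : Metric3} (hg : IsRiemannian g) (x : E3) (m i j : Fin 3) :
    ∑ l, nR g x m l l i j = covDeriv g (fun y => Ricci g y) m x i j := by
  unfold covDeriv Ricci nR
  rw [pd_sum' (fun l => Riemann_sm hg _ _ _ _)]
  simp only [Fin.sum_univ_three]
  ring

/-- The trace of a covariant derivative is the derivative of the trace. -/
lemma trace_covDeriv {g : Metric3} (hg : IsRiemannian g) (T : E3 → Fin 3 → Fin 3 → ℝ) (hT : ∀ i j, Sm (fun y => T y i j))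
    (x : E3) (m : Fin 3) :
    ∑ i, ∑ j, ginv g x i j * covDeriv g T m x i j
      = pd m (fun y => ∑ i, ∑ j, ginv g y i j * T y i j) x := by
  have s : ∀ i j, Sm (fun y => ginv g y i j * T y i j) := fun i j =>
    Sm.mul (ginv_sm hg _ _) (hT _ _)
  rw [pd_sum' (fun i => Sm.sum fun j => s i j)]
  simp only [pd_sum' (fun j => s _ j), pd_mul' (ginv_sm hg _ _) (hT _ _), pd_ginv hg, covDeriv]
  simp only [Fin.sum_univ_three]
  ring

/-- contracted second Bianchi identity -/
lemma contracted_bianchi {g : Metric3} (hg : IsRiemannian g) (x : E3) (m : Fin 3) :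
    pd m (fun y => Scal g y) x
      = 2 * ∑ j, ∑ k, ginv g x j k * covDeriv g (fun y => Ricci g y) j x m k := by
  have h1 := trace_covDeriv hg (fun y => Ricci g y) (Ricci_sm hg) x m
  have h2 : ∑ j, ∑ k, ∑ l, ginv g x j k *
      (nR g x m l l j k + nR g x l l j m k + nR g x j l m l k) = 0 := by
    simp only [bianchi hg]; simp
  have h3 : ∀ j l k, nR g x j l m l k = - nR g x j l l m k := fun j l k => nR_antisymm hg _ _ _ _ _ _
  have h4 : ∑ l, ∑ j, ∑ n, (nR g x l l j m n * ginv g x n j + nR g x l j j m n * ginv g x l n)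
      = 0 := by
    simp only [nR_skew hg]; simp
  have e : (fun y => Scal g y) = fun y => ∑ i, ∑ j, ginv g y i j * Ricci g y i j := rfl
  rw [e, ← h1]
  simp only [← nR_ricci hg]
  simp only [h3] at h2
  have s1 := ginv_symm hg x 1 0
  have s2 := ginv_symm hg x 2 0
  have s3 := ginv_symm hg x 2 1
  simp only [Fin.sum_univ_three, s1, s2, s3] at h2 h4 ⊢
  linear_combination h2 - h4

lemma covDeriv_Schouten {g : Metric3} (hg : IsRiemannian g) (x : E3) (k i j : Fin 3) :
    covDeriv g (fun y => Schouten g y) k x i j =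
      covDeriv g (fun y => Ricci g y) k x i j - pd k (fun y => Scal g y) x / 4 * g x i j := by
  unfold covDeriv Schouten
  have s : Sm (fun y => Scal g y / 4) := ContDiff.div_const (Scal_sm hg) 4
  have e : pd k (fun y => Scal g y / 4) x = pd k (fun y => Scal g y) x / 4 := by
    have := pd_mul' (Scal_sm hg) (h := fun _ => (1 / 4 : ℝ)) contDiff_const k x
    rw [pd_const'] at this
    have e0 : (fun y => Scal g y / 4) = fun y => Scal g y * (1 / 4) := by
      funext y; ring
    rw [e0, this]; ring
  rw [pd_sub' (Ricci_sm hg _ _) (Sm.mul s (g_sm hg _ _)), pd_mul' s (g_sm hg _ _), e, pd_g hg]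
  simp only [Fin.sum_univ_three]
  ring

lemma cotton_trace {g : Metric3} (hg : IsRiemannian g) (x : E3) (k : Fin 3) : ∑ i, ∑ j, ginv g x i j * CottonForm g x k i j = 0 := by
  have h1 := trace_covDeriv hg (fun y => Ricci g y) (Ricci_sm hg) x k
  have e : (fun y => ∑ i, ∑ j, ginv g y i j * Ricci g y i j) = fun y => Scal g y := rfl
  rw [e] at h1
  have h2 := contracted_bianchi hg x k
  have t1 : ∑ i, ∑ j, ginv g x i j * g x i j = 3 := by
    have : ∀ i, ∑ j, ginv g x i j * g x i j = 1 := by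
      intro i
      have := ginv_mul hg x i i
      simp only [if_true] at this
      rw [← this]
      exact Finset.sum_congr rfl fun m _ => by rw [hg.symm]
    simp [this]
  have t2 : ∑ i, pd i (fun y => Scal g y) x * ∑ j, ginv g x i j * g x k j
      = pd k (fun y => Scal g y) x := by
    have : ∀ i, ∑ j, ginv g x i j * g x k j = if i = k then 1 else 0 := by
      intro i
      rw [← ginv_mul hg x i k]
      exact Finset.sum_congr rfl fun m _ => by rw [hg.symm x k m]
    simp [this]
  unfold CottonForm
  simp only [covDeriv_Schouten hg]
  simp only [Fin.sum_univ_three] at h1 h2 t1 t2 ⊢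
  linear_combination h1 + h2 / 2 - pd k (fun y => Scal g y) x / 4 * t1 + t2 / 4

/-- Pure algebra: a 2-form-valued covector in dimension three with vanishing trace has
symmetric Hodge dual. -/
lemma star_symm (H : Fin 3 → Fin 3 → ℝ) (C : Fin 3 → Fin 3 → Fin 3 → ℝ)
    (hH : ∀ i j, H i j = H j i) (hC : ∀ k i j, C k i j = - C i k j)
    (ht : ∀ k, ∑ i, ∑ j, H i j * C k i j = 0) (m j : Fin 3) :
    ∑ a, ∑ b, ∑ k, ∑ i, eps3 a b m * H a k * H b i * C k i j
      = ∑ a, ∑ b, ∑ k, ∑ i, eps3 a b j * H a k * H b i * C k i m := by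
  have d : ∀ k j, C k k j = 0 := fun k j => by linarith [hC k k j]
  have c1 : ∀ j, C 1 0 j = - C 0 1 j := fun j => hC 1 0 j
  have c2 : ∀ j, C 2 0 j = - C 0 2 j := fun j => hC 2 0 j
  have c3 : ∀ j, C 2 1 j = - C 1 2 j := fun j => hC 2 1 j
  have s1 := hH 1 0
  have s2 := hH 2 0
  have s3 := hH 2 1
  have t0 := ht 0
  have t1 := ht 1
  have t2 := ht 2
  simp only [Fin.sum_univ_three, d, c1, c2, c3, s1, s2, s3] at t0 t1 t2 ⊢
  fin_cases m <;> fin_cases j <;> simp [eps3]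
  · linear_combination -2 * (H 0 2 * t0 + H 1 2 * t1 + H 2 2 * t2)
  · linear_combination 2 * (H 0 1 * t0 + H 1 1 * t1 + H 1 2 * t2)
  · linear_combination 2 * (H 0 2 * t0 + H 1 2 * t1 + H 2 2 * t2)
  · linear_combination -2 * (H 0 0 * t0 + H 0 1 * t1 + H 0 2 * t2)
  · linear_combination -2 * (H 0 1 * t0 + H 1 1 * t1 + H 1 2 * t2)
  · linear_combination 2 * (H 0 0 * t0 + H 0 1 * t1 + H 0 2 * t2)

/-- On an oriented Riemannian 3-manifold, the Cotton tensor
`Cott = * d^∇ Sch` is a symmetric 2-tensor. -/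
theorem cotton_tensor_symmetric (g : Metric3) (hg : IsRiemannian g) :
    ∀ (x : E3) (m j : Fin 3), CottonTensor g x m j = CottonTensor g x j m := by
  intro x m j
  unfold CottonTensor
  congr 1
  refine star_symm (ginv g x) (CottonForm g x) (ginv_symm hg x) ?_
    (cotton_trace hg x) m j
  intro k i j
  unfold CottonForm
  ring
end
end

section
/- On an oriented Riemannian 3-manifold, the Cotton tensor is divergence-free: (d^∇)* Cott(g) = 0. -/
open scoped BigOperators
noncomputable section

namespace CottonProof

def Sm (f : E3 → ℝ) : Prop := ContDiff ℝ (⊤ : ℕ∞) f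

lemma Sm.diff {f : E3 → ℝ} (hf : Sm f) (x : E3) : DifferentiableAt ℝ f x :=
  (hf.differentiable (by simp)).differentiableAt

lemma Sm.add {f h : E3 → ℝ} (hf : Sm f) (hh : Sm h) : Sm (fun x => f x + h x) := ContDiff.add hf hh
lemma Sm.sub {f h : E3 → ℝ} (hf : Sm f) (hh : Sm h) : Sm (fun x => f x - h x) := ContDiff.sub hf hh
lemma Sm.mul {f h : E3 → ℝ} (hf : Sm f) (hh : Sm h) : Sm (fun x => f x * h x) := ContDiff.mul hf hh
lemma Sm.const (c : ℝ) : Sm (fun _ => c) := contDiff_const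
lemma Sm.sum {f : Fin 3 → E3 → ℝ} (hf : ∀ i, Sm (f i)) : Sm (fun x => ∑ i, f i x) :=
  ContDiff.sum (fun i _ => hf i)
lemma Sm.pd {f : E3 → ℝ} (hf : Sm f) (k : Fin 3) : Sm (fun x => pd k f x) := by
  unfold Sm _root_.pd
  have h : ContDiff ℝ (⊤ : ℕ∞) (fderiv ℝ f) := ContDiff.fderiv_right hf (by simp)
  exact h.clm_apply contDiff_const

lemma pd_add {f h : E3 → ℝ} (hf : Sm f) (hh : Sm h) (k : Fin 3) (x : E3) :
    pd k (fun y => f y + h y) x = pd k f x + pd k h x := by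
  unfold pd
  rw [fderiv_fun_add (hf.diff x) (hh.diff x)]; rfl

lemma pd_sub {f h : E3 → ℝ} (hf : Sm f) (hh : Sm h) (k : Fin 3) (x : E3) :
    pd k (fun y => f y - h y) x = pd k f x - pd k h x := by
  unfold pd
  rw [fderiv_fun_sub (hf.diff x) (hh.diff x)]; rfl

lemma pd_mul {f h : E3 → ℝ} (hf : Sm f) (hh : Sm h) (k : Fin 3) (x : E3) :
    pd k (fun y => f y * h y) x = pd k f x * h x + f x * pd k h x := by
  unfold pd
  rw [fderiv_fun_mul (hf.diff x) (hh.diff x)]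
  simp; ring

lemma pd_const_mul {f : E3 → ℝ} (c : ℝ) (hf : Sm f) (k : Fin 3) (x : E3) :
    pd k (fun y => c * f y) x = c * pd k f x := by
  rw [pd_mul (Sm.const c) hf]
  simp [pd]

lemma pd_sum {f : Fin 3 → E3 → ℝ} (hf : ∀ i, Sm (f i)) (k : Fin 3) (x : E3) :
    pd k (fun y => ∑ i, f i y) x = ∑ i, pd k (f i) x := by
  simp only [Fin.sum_univ_three]
  rw [pd_add ((hf 0).add (hf 1)) (hf 2), pd_add (hf 0) (hf 1)]

lemma pd_comm {f : E3 → ℝ} (hf : Sm f) (k n : Fin 3) (x : E3) :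
    pd k (fun y => pd n f y) x = pd n (fun y => pd k f y) x := by
  have hs : IsSymmSndFDerivAt ℝ f x :=
    (ContDiff.contDiffAt hf).isSymmSndFDerivAt (by
      simp only [minSmoothness_of_isRCLikeNormedField]
      exact WithTop.coe_le_coe.2 (le_top : (2 : ℕ∞) ≤ ⊤))
  have hd : DifferentiableAt ℝ (fderiv ℝ f) x :=
    ((ContDiff.fderiv_right (m := (⊤ : ℕ∞)) hf (by simp)).differentiable (by simp)).differentiableAt
  unfold pd
  rw [fderiv_clm_apply hd (differentiableAt_const _), fderiv_clm_apply hd (differentiableAt_const _)]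
  simpa using hs.eq (Pi.single k 1) (Pi.single n 1)


lemma sm_g {g : Metric3} (hg : IsRiemannian g) (i j : Fin 3) : Sm (fun y => g y i j) := by
  have h := hg.smooth
  rw [contDiff_pi] at h
  exact (contDiff_pi.1 (h i)) j

lemma det_pos {g : Metric3} (hg : IsRiemannian g) (x : E3) : 0 < (Matrix.of (g x)).det := (hg.posdef x).det_pos

lemma sm_det {g : Metric3} (hg : IsRiemannian g) : Sm (fun y => (Matrix.of (g y)).det) := by
  simp only [Matrix.det_fin_three, Matrix.of_apply]
  have := sm_g hg
  have A : ∀ a b c d e f, Sm (fun y => g y a b * g y c d * g y e f) := fun a b c d e f =>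
    ((this a b).mul (this c d)).mul (this e f)
  exact (((((A _ _ _ _ _ _).sub (A _ _ _ _ _ _)).sub (A _ _ _ _ _ _)).add (A _ _ _ _ _ _)).add
    (A _ _ _ _ _ _)).sub (A _ _ _ _ _ _)

lemma sm_ginv {g : Metric3} (hg : IsRiemannian g) (i j : Fin 3) : Sm (fun y => ginv g y i j) := by
  have hi : Sm (fun y => ((Matrix.of (g y)).det)⁻¹) :=
    ContDiff.inv (sm_det hg) (fun x => (det_pos hg x).ne')
  have hG := sm_g hg
  have A : ∀ a b c d, Sm (fun y => g y a b * g y c d) := fun a b c d => (hG a b).mul (hG c d)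
  have hadj : Sm (fun y => (Matrix.of (g y)).adjugate i j) := by
    simp only [Matrix.adjugate_fin_three]
    have N : ∀ {f : E3 → ℝ}, Sm f → Sm (fun y => - f y) := fun h => ContDiff.neg h
    fin_cases i <;> fin_cases j <;> simp <;>
      first
      | exact (A _ _ _ _).sub (A _ _ _ _)
      | exact (N (A _ _ _ _)).add (A _ _ _ _)
  have := hi.mul hadj
  convert this using 2 with y
  simp [ginv, Matrix.inv_def, Ring.inverse_eq_inv']

lemma ginv_mul {g : Metric3} (hg : IsRiemannian g) (x : E3) (i j : Fin 3) : ∑ k, ginv g x i k * g x k j = if i = j then 1 else 0 := by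
  have h := Matrix.nonsing_inv_mul (Matrix.of (g x)) (det_pos hg x).ne'.isUnit
  have := congrFun (congrFun h i) j
  rw [Matrix.mul_apply, Matrix.one_apply] at this
  exact this

lemma g_mul {g : Metric3} (hg : IsRiemannian g) (x : E3) (i j : Fin 3) : ∑ k, g x i k * ginv g x k j = if i = j then 1 else 0 := by
  have h := Matrix.mul_nonsing_inv (Matrix.of (g x)) (det_pos hg x).ne'.isUnit
  have := congrFun (congrFun h i) j
  rw [Matrix.mul_apply, Matrix.one_apply] at this
  exact this

lemma ginv_symm {g : Metric3} (hg : IsRiemannian g) (x : E3) (i j : Fin 3) : ginv g x i j = ginv g x j i := by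
  have h : (Matrix.of (g x)).transpose = Matrix.of (g x) := by
    ext a b; simp [hg.symm x a b]
  have := Matrix.transpose_nonsing_inv (Matrix.of (g x))
  rw [h] at this
  exact congrFun (congrFun this j) i

lemma ginv_det {g : Metric3} (hg : IsRiemannian g) (x : E3) : (Matrix.of (ginv g x)).det * (Matrix.of (g x)).det = 1 := by
  have : Matrix.of (ginv g x) = (Matrix.of (g x))⁻¹ := by ext; rfl
  rw [this, Matrix.det_nonsing_inv, Ring.inverse_mul_cancel _ (det_pos hg x).ne'.isUnit]

lemma sm_Gamma {g : Metric3} (hg : IsRiemannian g) (k i j : Fin 3) : Sm (fun y => Gamma g y k i j) := by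
  unfold Gamma
  exact (Sm.const _).mul (Sm.sum fun l => (sm_ginv hg k l).mul
    ((((sm_g hg j l).pd i).add ((sm_g hg i l).pd j)).sub ((sm_g hg i j).pd l)))

lemma sm_Riemann {g : Metric3} (hg : IsRiemannian g) (l i j k : Fin 3) : Sm (fun y => Riemann g y l i j k) := by
  unfold Riemann
  have := sm_Gamma hg
  exact ((((this l j k).pd i).sub ((this l i k).pd j)).add
    (Sm.sum fun m => (this l i m).mul (this m j k))).sub
    (Sm.sum fun m => (this l j m).mul (this m i k))

lemma sm_Ricci {g : Metric3} (hg : IsRiemannian g) (i j : Fin 3) : Sm (fun y => Ricci g y i j) := Sm.sum fun l => sm_Riemann hg l l i j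

lemma sm_Scal {g : Metric3} (hg : IsRiemannian g) : Sm (fun y => Scal g y) :=
  Sm.sum fun i => Sm.sum fun j => (sm_ginv hg i j).mul (sm_Ricci hg i j)

lemma sm_Schouten {g : Metric3} (hg : IsRiemannian g) (i j : Fin 3) : Sm (fun y => Schouten g y i j) := by
  unfold Schouten
  simp only [div_eq_mul_inv]
  exact (sm_Ricci hg i j).sub (((sm_Scal hg).mul (Sm.const _)).mul (sm_g hg i j))

lemma Gamma_symm {g : Metric3} (hg : IsRiemannian g) (x : E3) (k i j : Fin 3) : Gamma g x k i j = Gamma g x k j i := by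
  unfold Gamma
  have : (fun y => g y i j) = fun y => g y j i := by ext y; exact hg.symm y i j
  rw [this]
  congr 1
  refine Finset.sum_congr rfl fun l _ => ?_
  ring

lemma lower_Gamma {g : Metric3} (hg : IsRiemannian g) (x : E3) (n i j : Fin 3) : ∑ m, g x n m * Gamma g x m i j =
    (1/2) * (pd i (fun y => g y j n) x + pd j (fun y => g y i n) x - pd n (fun y => g y i j) x) := by
  unfold Gamma
  have h := g_mul hg x n
  have key : ∀ v : Fin 3 → ℝ, ∑ m, g x n m * (1/2 * ∑ l, ginv g x m l * v l) = 1/2 * v n := by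
    intro v
    have h0 := h 0
    have h1 := h 1
    have h2 := h 2
    have hv : v n = ∑ l, (if n = l then 1 else 0) * v l := by simp
    rw [hv]
    simp only [Fin.sum_univ_three] at *
    linear_combination (1/2 * v 0) * h0 + (1/2 * v 1) * h1 + (1/2 * v 2) * h2
  exact key fun l => (pd i (fun y => g y j l) x + pd j (fun y => g y i l) x - pd l (fun y => g y i j) x)

lemma compat {g : Metric3} (hg : IsRiemannian g) (x : E3) (k l n : Fin 3) : pd k (fun y => g y l n) x =
    ∑ m, g x n m * Gamma g x m k l + ∑ m, g x l m * Gamma g x m k n := by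
  rw [lower_Gamma hg, lower_Gamma hg]
  have h1 : (fun y => g y l n) = fun y => g y n l := by ext y; exact hg.symm y l n
  rw [h1]
  ring


/-- Lowered curvature. -/
def Rl (g : Metric3) (x : E3) (p k n j : Fin 3) : ℝ := ∑ q, g x p q * Riemann g x q k n j


lemma Rl_raise {g : Metric3} (hg : IsRiemannian g) (x : E3) (q k n j : Fin 3) :
    Riemann g x q k n j = ∑ p, ginv g x q p * Rl g x p k n j := by
  unfold Rl
  generalize hv : (fun q => Riemann g x q k n j) = v
  have hv' : ∀ q, Riemann g x q k n j = v q := fun q => by rw [← hv]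
  simp only [hv']
  have h := ginv_mul hg x q
  have h0 := h 0
  have h1 := h 1
  have h2 := h 2
  have hv : v q = ∑ l, (if q = l then 1 else 0) * v l := by simp
  rw [hv]
  simp only [Fin.sum_univ_three] at *
  linear_combination -(v 0) * h0 - (v 1) * h1 - (v 2) * h2

lemma Rl_anti {g : Metric3} (x : E3) (p k n j : Fin 3) : Rl g x p k n j = - Rl g x p n k j := by
  unfold Rl Riemann
  simp only [Fin.sum_univ_three]; ring

lemma Rl_bianchi {g : Metric3} (hg : IsRiemannian g) (x : E3) (p k n j : Fin 3) :
    Rl g x p k n j + Rl g x p n j k + Rl g x p j k n = 0 := by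
  unfold Rl
  rw [← Finset.sum_add_distrib, ← Finset.sum_add_distrib]
  refine Finset.sum_eq_zero fun q _ => ?_
  unfold Riemann
  simp only [Gamma_symm hg _ _ j n, Gamma_symm hg _ _ j k, Gamma_symm hg _ _ n k]
  simp only [Fin.sum_univ_three]; ring

lemma pd2 {g : Metric3} (hg : IsRiemannian g) (x : E3) (k n p j : Fin 3) : pd k (fun y => pd n (fun z => g z p j) y) x =
    ∑ m, ((∑ r, g x m r * Gamma g x r k j + ∑ r, g x j r * Gamma g x r k m) * Gamma g x m n p
      + g x j m * pd k (fun y => Gamma g y m n p) x)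
    + ∑ m, ((∑ r, g x m r * Gamma g x r k p + ∑ r, g x p r * Gamma g x r k m) * Gamma g x m n j
      + g x p m * pd k (fun y => Gamma g y m n j) x) := by
  have : (fun y => pd n (fun z => g z p j) y) = fun y =>
     ∑ m, g y j m * Gamma g y m n p + ∑ m, g y p m * Gamma g y m n j := by
    ext y; exact compat hg y n p j
  rw [this]
  have hG := sm_Gamma hg
  have hgg := sm_g hg
  rw [pd_add (Sm.sum fun m => (hgg j m).mul (hG m n p)) (Sm.sum fun m => (hgg p m).mul (hG m n j)),
    pd_sum (fun m => (hgg j m).mul (hG m n p)), pd_sum (fun m => (hgg p m).mul (hG m n j))]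
  congr 1
  · refine Finset.sum_congr rfl fun m _ => ?_
    rw [pd_mul (hgg j m) (hG m n p), compat hg]
  · refine Finset.sum_congr rfl fun m _ => ?_
    rw [pd_mul (hgg p m) (hG m n j), compat hg]

lemma Rl_anti2 {g : Metric3} (hg : IsRiemannian g) (x : E3) (p k n j : Fin 3) : Rl g x p k n j = - Rl g x j k n p := by
  have h := pd_comm (sm_g hg p j) k n x
  rw [pd2 hg, pd2 hg] at h
  unfold Rl Riemann
  have h1 := hg.symm x 1 0
  have h2 := hg.symm x 2 0
  have h3 := hg.symm x 2 1
  simp only [Fin.sum_univ_three, h1, h2, h3] at *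
  linear_combination h


lemma final_alg (h : Fin 3 → Fin 3 → ℝ) (R : Fin 3 → Fin 3 → Fin 3 → Fin 3 → ℝ)
    (hs : ∀ i j, h i j = h j i)
    (h1 : ∀ p k n j, R p k n j = - R p n k j)
    (h2 : ∀ p k n j, R p k n j = - R j k n p)
    (h3 : ∀ p k n j, R p k n j + R p n j k + R p j k n = 0) (j : Fin 3) :
    ∑ k, ∑ i, ∑ n, ∑ p, ∑ q, eps3 k i n * (∑ a, ∑ b, h a b * R b a i p) * h p q * R q k n j = 0 := by
  have hz1 : ∀ p k j, R p k k j = 0 := fun p k j => by linarith [h1 p k k j]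
  have hz2 : ∀ p k n, R p k n p = 0 := fun p k n => by linarith [h2 p k n p]
  have hp : ∀ p k n j, R p k n j = R k p j n := by
    intro p k n j
    linarith [h3 p k n j, h3 k n j p, h3 n j p k, h3 j p k n, h1 p k n j, h2 p k n j,
      h1 k n j p, h1 n j p k, h1 j p k n, h1 p n j k, h1 p j k n, h1 k j p n, h1 k p n j, h1 n p k j, h1 n k j p,
      h1 j k n p, h1 j n p k, h2 k n j p, h2 n j p k, h2 j p k n, h2 p n j k, h2 p j k n, h2 k j p n, h2 k p n j,
      h2 n p k j, h2 n k j p, h2 j k n p, h2 j n p k]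
  -- normal form
  have e10 : ∀ p j, R p 1 0 j = - R p 0 1 j := fun p j => h1 _ _ _ _
  have e20 : ∀ p j, R p 2 0 j = - R p 0 2 j := fun p j => h1 _ _ _ _
  have e21 : ∀ p j, R p 2 1 j = - R p 1 2 j := fun p j => h1 _ _ _ _
  have f10 : ∀ k n, R 1 k n 0 = - R 0 k n 1 := fun p j => h2 _ _ _ _
  have f20 : ∀ k n, R 2 k n 0 = - R 0 k n 2 := fun p j => h2 _ _ _ _
  have f21 : ∀ k n, R 2 k n 1 = - R 1 k n 2 := fun p j => h2 _ _ _ _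
  have p1 : R 0 0 2 1 = R 0 0 1 2 := by linarith [hp 0 0 2 1, hp 0 0 1 2, h1 0 0 2 1, h2 0 0 2 1, h3 0 0 2 1, h3 0 0 1 2, h1 0 1 0 2, h2 0 1 0 2, h1 0 2 0 1, hz1 0 0 1, h3 0 1 0 2, h3 0 1 2 0, hz2 0 1 2, hz2 0 2 1]
  have p2 : R 0 1 2 1 = R 1 0 1 2 := by linarith [hp 0 1 2 1]
  have p3 : R 0 1 2 2 = R 1 0 2 2 := by linarith [hp 0 1 2 2]
  have q2 : h 1 0 = h 0 1 := hs _ _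
  have q3 : h 2 0 = h 0 2 := hs _ _
  have q4 : h 2 1 = h 1 2 := hs _ _
  fin_cases j <;>
  simp [Fin.sum_univ_three, eps3, hz1, hz2, e10, e20, e21, f10, f20, f21, p1, p2, p3, q2, q3, q4] <;> ring

lemma eps_det (h : Fin 3 → Fin 3 → ℝ) (k i n : Fin 3) :
    ∑ a, ∑ b, ∑ c, eps3 a b c * h a k * h b i * h c n = (Matrix.of h).det * eps3 k i n := by
  rw [Matrix.det_fin_three]
  fin_cases k <;> fin_cases i <;> fin_cases n <;> simp [Fin.sum_univ_three, eps3] <;> ring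

lemma eps_anti (k i n : Fin 3) : eps3 i k n = - eps3 k i n := by
  fin_cases k <;> fin_cases i <;> fin_cases n <;> simp [eps3]

lemma eps_anti2 (k i n : Fin 3) : eps3 n i k = - eps3 k i n := by
  fin_cases k <;> fin_cases i <;> fin_cases n <;> simp [eps3]

/-- `ε^{kin} (d^∇ Sch)_{ki}` components. -/
def W (g : Metric3) (y : E3) (n j : Fin 3) : ℝ :=
  ∑ k, ∑ i, eps3 k i n * (pd k (fun z => Schouten g z i j) y
    - ∑ m, Gamma g y m k j * Schouten g y i m)

def om (g : Metric3) (y : E3) : ℝ := (Real.sqrt (Matrix.of (g y)).det)⁻¹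

def U (g : Metric3) (y : E3) (n j : Fin 3) : ℝ := om g y * W g y n j


lemma eps_g {g : Metric3} (hg : IsRiemannian g) (x : E3) (k i m : Fin 3) :
    ∑ a, ∑ b, eps3 a b m * ginv g x a k * ginv g x b i =
      (Matrix.of (ginv g x)).det * ∑ n, g x m n * eps3 k i n := by
  have h := fun n => eps_det (ginv g x) k i n
  have h0 := h 0
  have h1 := h 1
  have h2 := h 2
  have hd := fun c => ginv_mul hg x c m
  have hv : ∀ a b, eps3 a b m = ∑ c, (∑ n, ginv g x c n * g x n m) * eps3 a b c := by
    intro a b; simp [hd]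
  simp only [hv]
  generalize (Matrix.of (ginv g x)).det = D at *
  simp only [Fin.sum_univ_three, hg.symm x m 0, hg.symm x m 1, hg.symm x m 2] at *
  linear_combination g x 0 m * h0 + g x 1 m * h1 + g x 2 m * h2

lemma om_eq {g : Metric3} (hg : IsRiemannian g) (x : E3) : Real.sqrt (Matrix.of (g x)).det * (Matrix.of (ginv g x)).det = om g x := by
  have h := ginv_det hg x
  have hp := det_pos hg x
  have hs := Real.mul_self_sqrt hp.le
  have hs0 : Real.sqrt (Matrix.of (g x)).det ≠ 0 := (Real.sqrt_pos.2 hp).ne'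
  unfold om
  field_simp
  rw [sq, hs, mul_comm]
  exact h

lemma W_eq {g : Metric3} (hg : IsRiemannian g) (x : E3) (n j : Fin 3) :
    ∑ k, ∑ i, eps3 k i n * CottonForm g x k i j = 2 * W g x n j := by
  unfold CottonForm covDeriv W
  have s1 := Gamma_symm hg x
  have a1 : ∀ m, Gamma g x m 1 0 = Gamma g x m 0 1 := fun m => s1 _ _ _
  have a2 : ∀ m, Gamma g x m 2 0 = Gamma g x m 0 2 := fun m => s1 _ _ _
  have a3 : ∀ m, Gamma g x m 2 1 = Gamma g x m 1 2 := fun m => s1 _ _ _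
  fin_cases n <;> simp [eps3, Fin.sum_univ_three, a1, a2, a3] <;> ring

lemma Cotton_eq {g : Metric3} (hg : IsRiemannian g) (x : E3) (m j : Fin 3) :
    CottonTensor g x m j = ∑ n, g x m n * U g x n j := by
  have h1 : CottonTensor g x m j = Real.sqrt (Matrix.of (g x)).det / 2 *
      ∑ k, ∑ i, (∑ a, ∑ b, eps3 a b m * ginv g x a k * ginv g x b i) * CottonForm g x k i j := by
    unfold CottonTensor
    simp only [Fin.sum_univ_three]; ring
  have h2 := fun n => W_eq hg x n j
  rw [h1]
  simp only [eps_g hg, U, ← om_eq hg]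
  have h3 : ∀ n, W g x n j = 1/2 * ∑ k, ∑ i, eps3 k i n * CottonForm g x k i j := by
    intro n; rw [h2]; ring
  simp only [h3]
  simp only [Fin.sum_univ_three]; ring

lemma sm_W {g : Metric3} (hg : IsRiemannian g) (n j : Fin 3) : Sm (fun y => W g y n j) :=
  Sm.sum fun k => Sm.sum fun i => (Sm.const _).mul (((sm_Schouten hg i j).pd k).sub
    (Sm.sum fun m => (sm_Gamma hg m k j).mul (sm_Schouten hg i m)))

lemma sm_om {g : Metric3} (hg : IsRiemannian g) : Sm (fun y => om g y) :=
  ContDiff.inv (ContDiff.sqrt (sm_det hg) fun x => (det_pos hg x).ne')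
    fun x => (Real.sqrt_pos.2 (det_pos hg x)).ne'

lemma sm_U {g : Metric3} (hg : IsRiemannian g) (n j : Fin 3) : Sm (fun y => U g y n j) := (sm_om hg).mul (sm_W hg n j)

lemma pd_det {g : Metric3} (hg : IsRiemannian g) (x : E3) (k : Fin 3) : pd k (fun y => (Matrix.of (g y)).det) x =
    2 * (Matrix.of (g x)).det * ∑ m, Gamma g x m k m := by
  simp only [Matrix.det_fin_three, Matrix.of_apply]
  have hG := sm_g hg
  have A2 : ∀ a b c d, Sm (fun y => g y a b * g y c d) := fun a b c d =>
    (hG a b).mul (hG c d)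
  have A : ∀ a b c d e f, Sm (fun y => g y a b * g y c d * g y e f) := fun a b c d e f =>
    (A2 a b c d).mul (hG e f)
  have P : ∀ a b c d e f, pd k (fun y => g y a b * g y c d * g y e f) x =
      (pd k (fun y => g y a b) x * g x c d + g x a b * pd k (fun y => g y c d) x) * g x e f
        + g x a b * g x c d * pd k (fun y => g y e f) x := by
    intro a b c d e f
    rw [pd_mul (A2 a b c d) (hG e f), pd_mul (hG a b) (hG c d)]
  rw [pd_sub (((((A _ _ _ _ _ _).sub (A _ _ _ _ _ _)).sub (A _ _ _ _ _ _)).add (A _ _ _ _ _ _)).add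
    (A _ _ _ _ _ _)) (A _ _ _ _ _ _), pd_add ((((A _ _ _ _ _ _).sub (A _ _ _ _ _ _)).sub
    (A _ _ _ _ _ _)).add (A _ _ _ _ _ _)) (A _ _ _ _ _ _), pd_add (((A _ _ _ _ _ _).sub
    (A _ _ _ _ _ _)).sub (A _ _ _ _ _ _)) (A _ _ _ _ _ _), pd_sub ((A _ _ _ _ _ _).sub
    (A _ _ _ _ _ _)) (A _ _ _ _ _ _), pd_sub (A _ _ _ _ _ _) (A _ _ _ _ _ _)]
  simp only [P, compat hg]
  have h1 := hg.symm x 1 0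
  have h2 := hg.symm x 2 0
  have h3 := hg.symm x 2 1
  simp only [Fin.sum_univ_three, h1, h2, h3]
  ring

lemma pd_om {g : Metric3} (hg : IsRiemannian g) (x : E3) (k : Fin 3) :
    pd k (fun y => om g y) x = - om g x * ∑ m, Gamma g x m k m := by
  have hp := det_pos hg x
  have h2 : (fun y => om g y * om g y * (Matrix.of (g y)).det) = fun _ => (1 : ℝ) := by
    ext y
    have hp := det_pos hg y
    have hs := Real.mul_self_sqrt hp.le
    have hs0 : Real.sqrt (Matrix.of (g y)).det ≠ 0 := (Real.sqrt_pos.2 hp).ne'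
    unfold om
    field_simp
    rw [sq, hs]
  have h3 : pd k (fun y => om g y * om g y * (Matrix.of (g y)).det) x = 0 := by
    rw [h2]; simp [pd]
  rw [pd_mul ((sm_om hg).mul (sm_om hg)) (sm_det hg), pd_mul (sm_om hg) (sm_om hg), pd_det hg] at h3
  have ho : om g x ≠ 0 := inv_ne_zero (Real.sqrt_pos.2 hp).ne'
  have : (2 * om g x * (Matrix.of (g x)).det) *
      (pd k (fun y => om g y) x + om g x * ∑ m, Gamma g x m k m) = 0 := by
    linear_combination h3
  have := (mul_eq_zero.1 this).resolve_left (by positivity)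
  linear_combination this

lemma cov_Cotton {g : Metric3} (hg : IsRiemannian g) (x : E3) (k l j : Fin 3) :
    covDeriv g (fun y => CottonTensor g y) k x l j =
      ∑ n, g x l n * (pd k (fun y => U g y n j) x + ∑ m, Gamma g x n k m * U g x m j
        - ∑ m, Gamma g x m k j * U g x n m) := by
  unfold covDeriv
  simp only [Cotton_eq hg]
  rw [pd_sum (fun n => (sm_g hg l n).mul (sm_U hg n j))]
  simp only [pd_mul (sm_g hg l _) (sm_U hg _ j), compat hg]
  have h1 := hg.symm x 1 0
  have h2 := hg.symm x 2 0
  have h3 := hg.symm x 2 1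
  simp only [Fin.sum_univ_three, h1, h2, h3]
  ring

lemma div1 {g : Metric3} (hg : IsRiemannian g) (x : E3) (j : Fin 3) :
    ∑ k, ∑ l, ginv g x k l * covDeriv g (fun y => CottonTensor g y) k x l j =
     ∑ k, (pd k (fun y => U g y k j) x + ∑ m, Gamma g x k k m * U g x m j
        - ∑ m, Gamma g x m k j * U g x k m) := by
  refine Finset.sum_congr rfl fun k _ => ?_
  simp only [cov_Cotton hg]
  have key : ∀ v : Fin 3 → ℝ, ∑ l, ginv g x k l * ∑ n, g x l n * v n = v k := by
    intro v
    have h := ginv_mul hg x k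
    have h0 := h 0
    have h1 := h 1
    have h2 := h 2
    have hv : v k = ∑ l, (if k = l then 1 else 0) * v l := by simp
    rw [hv]
    simp only [Fin.sum_univ_three] at *
    linear_combination (v 0) * h0 + (v 1) * h1 + (v 2) * h2
  exact key fun n => (pd k (fun y => U g y n j) x + ∑ m, Gamma g x n k m * U g x m j
        - ∑ m, Gamma g x m k j * U g x n m)

lemma div2 {g : Metric3} (hg : IsRiemannian g) (x : E3) (j : Fin 3) :
    ∑ k, (pd k (fun y => U g y k j) x + ∑ m, Gamma g x k k m * U g x m j
        - ∑ m, Gamma g x m k j * U g x k m) =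
      om g x * ∑ k, (pd k (fun y => W g y k j) x - ∑ m, Gamma g x m k j * W g x k m) := by
  have h : ∀ k, pd k (fun y => U g y k j) x =
      - om g x * (∑ m, Gamma g x m k m) * W g x k j + om g x * pd k (fun y => W g y k j) x := by
    intro k
    rw [← pd_om hg, ← pd_mul (sm_om hg) (sm_W hg k j)]; rfl
  simp only [h]
  simp only [U]
  have s1 := Gamma_symm hg x
  have a1 : ∀ m, Gamma g x m 1 0 = Gamma g x m 0 1 := fun m => s1 _ _ _
  have a2 : ∀ m, Gamma g x m 2 0 = Gamma g x m 0 2 := fun m => s1 _ _ _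
  have a3 : ∀ m, Gamma g x m 2 1 = Gamma g x m 1 2 := fun m => s1 _ _ _
  simp only [Fin.sum_univ_three, a1, a2, a3]
  ring

lemma pd_W {g : Metric3} (hg : IsRiemannian g) (x : E3) (n j : Fin 3) : pd n (fun y => W g y n j) x =
    ∑ k, ∑ i, eps3 k i n * (pd n (fun y => pd k (fun z => Schouten g z i j) y) x
    - ∑ m, (pd n (fun y => Gamma g y m k j) x * Schouten g x i m
      + Gamma g x m k j * pd n (fun y => Schouten g y i m) x)) := by
  unfold W
  have hS := sm_Schouten hg
  have hG := sm_Gamma hg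
  have s3 : ∀ k i, Sm (fun y => ∑ m, Gamma g y m k j * Schouten g y i m) := fun k i =>
    Sm.sum fun m => (hG m k j).mul (hS i m)
  have s2 : ∀ k i, Sm (fun y => pd k (fun z => Schouten g z i j) y
    - ∑ m, Gamma g y m k j * Schouten g y i m) := fun k i => ((hS i j).pd k).sub (s3 k i)
  have s1 : ∀ k i, Sm (fun y => eps3 k i n * (pd k (fun z => Schouten g z i j) y
    - ∑ m, Gamma g y m k j * Schouten g y i m)) := fun k i => (Sm.const _).mul (s2 k i)
  rw [pd_sum (fun k => Sm.sum (s1 k))]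
  refine Finset.sum_congr rfl fun k _ => ?_
  rw [pd_sum (s1 k)]
  refine Finset.sum_congr rfl fun i _ => ?_
  rw [pd_const_mul _ (s2 k i), pd_sub ((hS i j).pd k) (s3 k i),
    pd_sum (fun m => (hG m k j).mul (hS i m))]
  simp only [pd_mul (hG _ k j) (hS i _)]

lemma div3 {g : Metric3} (hg : IsRiemannian g) (x : E3) (j : Fin 3) :
    ∑ n, (pd n (fun y => W g y n j) x - ∑ m, Gamma g x m n j * W g x n m) =
      1/2 * ∑ k, ∑ i, ∑ n, ∑ p, eps3 k i n * Schouten g x i p * Riemann g x p k n j := by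
  simp only [pd_W hg]
  unfold W Riemann
  have hc : ∀ i, ∀ k n, pd k (fun y => pd n (fun z => Schouten g z i j) y) x =
    pd n (fun y => pd k (fun z => Schouten g z i j) y) x := fun i k n =>
    pd_comm (sm_Schouten hg i j) k n x
  have c1 := fun i => hc i 1 0
  have c2 := fun i => hc i 2 0
  have c3 := fun i => hc i 2 1
  simp [Fin.sum_univ_three, eps3, c1, c2, c3]
  ring

lemma div4 {g : Metric3} (hg : IsRiemannian g) (x : E3) (j : Fin 3) :
    ∑ k, ∑ i, ∑ n, ∑ p, eps3 k i n * Schouten g x i p * Riemann g x p k n j = 0 := by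
  have hA := final_alg (ginv g x) (Rl g x) (ginv_symm hg x) (Rl_anti x) (Rl_anti2 hg x)
    (Rl_bianchi hg x) j
  have hR : ∀ i p, Ricci g x i p = ∑ a, ∑ b, ginv g x a b * Rl g x b a i p := by
    intro i p
    unfold Ricci
    exact Finset.sum_congr rfl fun l _ => Rl_raise hg x l l i p
  have h1 : ∑ k, ∑ i, ∑ n, ∑ p, eps3 k i n * Ricci g x i p * Riemann g x p k n j = 0 := by
    rw [← hA]
    simp only [← hR]
    refine Finset.sum_congr rfl fun k _ => Finset.sum_congr rfl fun i _ =>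
      Finset.sum_congr rfl fun n _ => Finset.sum_congr rfl fun p _ => ?_
    rw [Rl_raise hg, Finset.mul_sum]
    exact Finset.sum_congr rfl fun q _ => by ring
  have h2 : ∑ k, ∑ i, ∑ n, eps3 k i n * Rl g x i k n j = 0 := by
    have b := Rl_anti2 hg x
    have e : ∀ i k n, Rl g x i k n j = - Rl g x j k n i := fun i k n => b _ _ _ _
    have b1 := Rl_bianchi hg x j 0 1 2
    have b2 := Rl_bianchi hg x j 1 0 2
    simp only [e]
    simp [Fin.sum_univ_three, eps3]
    linarith
  have h3 : ∑ k, ∑ i, ∑ n, ∑ p, eps3 k i n * Schouten g x i p * Riemann g x p k n j =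
      ∑ k, ∑ i, ∑ n, ∑ p, eps3 k i n * Ricci g x i p * Riemann g x p k n j
      - Scal g x / 4 * ∑ k, ∑ i, ∑ n, eps3 k i n * Rl g x i k n j := by
    unfold Rl Schouten
    simp only [Finset.mul_sum, ← Finset.sum_sub_distrib]
    refine Finset.sum_congr rfl fun k _ => Finset.sum_congr rfl fun i _ =>
      Finset.sum_congr rfl fun n _ => Finset.sum_congr rfl fun p _ => ?_
    ring
  rw [h3, h1, h2]; ring


end CottonProof

/-- On an oriented Riemannian 3-manifold, the Cotton tensor is
divergence-free: `(d^∇)* Cott(g) = 0`. -/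
theorem cotton_tensor_divergence_free (g : Metric3) (hg : IsRiemannian g) :
    ∀ (x : E3) (j : Fin 3),
      ∑ k, ∑ l, ginv g x k l * covDeriv g (fun y => CottonTensor g y) k x l j = 0 := by
  intro x j
  rw [CottonProof.div1 hg, CottonProof.div2 hg, CottonProof.div3 hg, CottonProof.div4 hg]
  simp
end
end
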